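/- arXiv:2504.03399 — 2 statements merged into one kernel-verified Lean document; each statement's English description precedes it below -/
import Mathlib

section
/- Fix open sets I_ν ⊆ X (ν ∈ N) and a constant α > 0. Let (g^n) and ĝ be abstract economy profiles, each satisfying: (A1) the constraint and preference maps are upper semicontinuous with compact convex values; (A2) the constraint maps have nonempty values; (A3) with common improvement sets, i.e., {x ∈ X : C_ν(x) ∩ P_ν(x) ≠ ∅} = I_ν for every ν and each of these profiles; and (Ψ2) with the common constant α: for every ε > 0, every ν, and every x with C_ν(x) ∩ P_ν(x) ≠ ∅, N_ε[C_ν(x)] ∩ N_ε[P_ν(x)] ⊆ N_{αε}[C_ν(x) ∩ P_ν(x)]. Assume ρ(g^n, ĝ) → 0. Then for every sequence (x^n) in X converging to x̂ ∈ X, liminf_{n→∞} γ(g^n; x^n) ≥ γ(ĝ; x̂); i.e., the gap function γ is sequentially lower semicontinuous on this class. -/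
open Metric Set Filter Topology
open scoped ENNReal

/-- Upper semicontinuity of a set-valued map. -/
def UpperSemicontinuousSV {D Y : Type*} [TopologicalSpace D] [TopologicalSpace Y]
    (F : D → Set Y) : Prop :=
  ∀ x : D, ∀ U : Set Y, IsOpen U → F x ⊆ U → ∀ᶠ x' in nhds x, F x' ⊆ U

open Classical in
/-- The map `G_ν(g;·)`: the intersection `C x ∩ P x` when it is nonempty, and `C x` otherwise. -/
noncomputable def Gmap {A B : Type*} (C P : A → Set B) (x : A) : Set B :=
  if (C x ∩ P x).Nonempty then C x ∩ P x else C x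

/-- The gap function `γ(g;x) = max_ν d(x_ν, G_ν(g;x))` of the abstract economy `g = (C, P)`. -/
noncomputable def gapFun {N : Type*} [Fintype N]
    {E : N → Type*} [∀ ν, NormedAddCommGroup (E ν)]
    {X : ∀ ν, Set (E ν)}
    (C P : ∀ ν : N, ((μ : N) → X μ) → Set (E ν)) (x : (μ : N) → X μ) : ℝ :=
  ⨆ ν, Metric.infDist (x ν : E ν) (Gmap (C ν) (P ν) x)

/-- The distance `ρ` between two abstract economy profiles. -/
noncomputable def rho {N : Type*} [Fintype N]
    {E : N → Type*} [∀ ν, NormedAddCommGroup (E ν)]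
    {X : ∀ ν, Set (E ν)}
    (C C' P P' : ∀ ν : N, ((μ : N) → X μ) → Set (E ν)) : ℝ≥0∞ :=
  ∑ ν, ((⨆ x, EMetric.hausdorffEdist (C ν x) (C' ν x)) +
        (⨆ x, EMetric.hausdorffEdist (P ν x) (P' ν x)))

/-- If `s` is nonempty and contained in the `ε`-thickening of `t`, then passing from `s` to `t`
increases the infimum distance by at most `ε`. -/
theorem infDist_le_of_subset_thickening {Y : Type*} [PseudoMetricSpace Y] {s t : Set Y} {ε : ℝ}
    (hs : s.Nonempty) (h : s ⊆ Metric.thickening ε t) (x y : Y) :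
    Metric.infDist x t ≤ dist x y + Metric.infDist y s + ε := by
  have key : Metric.infDist y t - ε ≤ Metric.infDist y s := by
    rw [Metric.le_infDist hs]
    intro z hz
    obtain ⟨w, hw, hzw⟩ := Metric.mem_thickening_iff.1 (h hz)
    have h₁ := Metric.infDist_le_dist_of_mem (x := y) hw
    linarith [dist_triangle y z w]
  linarith [Metric.infDist_le_infDist_add_dist (s := t) (x := x) (y := y)]

theorem subset_thickening_of_hausdorffEDist_lt {Y : Type*} [PseudoMetricSpace Y] {s t : Set Y}
    {ε : ℝ} (h : Metric.hausdorffEDist s t < ENNReal.ofReal ε) :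
    s ⊆ Metric.thickening ε t := fun _ hz =>
  (Metric.infEDist_le_hausdorffEDist_of_mem hz).trans_lt h

/-- If `F n` converges uniformly in Hausdorff distance to an upper semicontinuous `G`, then the
values `F n (x n)` along a convergent sequence are eventually close to the value of `G` at the
limit. -/
theorem UpperSemicontinuousSV.eventually_subset_thickening {D Y : Type*} [TopologicalSpace D]
    [PseudoMetricSpace Y] {F : ℕ → D → Set Y} {G : D → Set Y} (hG : UpperSemicontinuousSV G)
    (hF : Tendsto (fun n => ⨆ x, Metric.hausdorffEDist (F n x) (G x)) atTop (𝓝 0))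
    {x : ℕ → D} {x₀ : D} (hx : Tendsto x atTop (𝓝 x₀)) {ε : ℝ} (hε : 0 < ε) :
    ∀ᶠ n in atTop, F n (x n) ⊆ Metric.thickening ε (G x₀) := by
  have h₁ := hF.eventually_lt_const (ENNReal.ofReal_pos.2 (half_pos hε))
  have h₂ := hx.eventually (hG x₀ _ Metric.isOpen_thickening
    (Metric.self_subset_thickening (half_pos hε) (G x₀)))
  filter_upwards [h₁, h₂] with n hn₁ hn₂
  have hsub := subset_thickening_of_hausdorffEDist_lt ((le_iSup _ (x n)).trans_lt hn₁)
  calc F n (x n) ⊆ Metric.thickening (ε / 2) (G (x n)) := hsub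
    _ ⊆ Metric.thickening (ε / 2) (Metric.thickening (ε / 2) (G x₀)) :=
      Metric.thickening_subset_of_subset _ hn₂
    _ ⊆ Metric.thickening (ε / 2 + ε / 2) (G x₀) := Metric.thickening_thickening_subset _ _ _
    _ = Metric.thickening ε (G x₀) := by rw [add_halves]

theorem Gmap_subset {A B : Type*} (C P : A → Set B) (x : A) : Gmap C P x ⊆ C x := by
  unfold Gmap
  split_ifs
  exacts [inter_subset_left, Subset.rfl]

theorem Gmap_nonempty {A B : Type*} {C : A → Set B} (P : A → Set B) {x : A}
    (h : (C x).Nonempty) : (Gmap C P x).Nonempty := by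
  unfold Gmap
  split_ifs with hx
  exacts [hx, h]

/-- sequential lower semicontinuity of the gap function on a class of abstract
economy profiles sharing the improvement sets `I_ν` (condition (A3)) and the regularity
constant `α` (condition (Ψ2)): if `ρ(gⁿ, ĝ) → 0` and `xⁿ → x̂`, then
`liminf_n γ(gⁿ; xⁿ) ≥ γ(ĝ; x̂)`. -/
theorem gapFun_lower_semicontinuous
    {N : Type*} [Fintype N] [Nonempty N]
    {E : N → Type*} [∀ ν, NormedAddCommGroup (E ν)] [∀ ν, NormedSpace ℝ (E ν)]
    [∀ ν, CompleteSpace (E ν)]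
    (X : ∀ ν, Set (E ν))
    (hXne : ∀ ν, (X ν).Nonempty) (hXcp : ∀ ν, IsCompact (X ν)) (hXcv : ∀ ν, Convex ℝ (X ν))
    -- fixed open improvement sets and regularity constant
    (I : ∀ _ : N, Set ((μ : N) → X μ)) (hIopen : ∀ ν, IsOpen (I ν))
    (a : ℝ) (ha : 0 < a)
    -- the sequence of profiles and its limit candidate
    (C P : ℕ → ∀ ν : N, ((μ : N) → X μ) → Set (E ν))
    (Chat Phat : ∀ ν : N, ((μ : N) → X μ) → Set (E ν))
    -- each gⁿ is an abstract economy profile satisfying (A1), (A2), (A3), (Ψ2)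
    (hCsub : ∀ n ν x, C n ν x ⊆ X ν) (hPsub : ∀ n ν x, P n ν x ⊆ X ν)
    (hCdep : ∀ n ν x y, (∀ μ, μ ≠ ν → x μ = y μ) → C n ν x = C n ν y)
    (hCusc : ∀ n ν, UpperSemicontinuousSV (C n ν))
    (hPusc : ∀ n ν, UpperSemicontinuousSV (P n ν))
    (hCcp : ∀ n ν x, IsCompact (C n ν x)) (hCcv : ∀ n ν x, Convex ℝ (C n ν x))
    (hPcp : ∀ n ν x, IsCompact (P n ν x)) (hPcv : ∀ n ν x, Convex ℝ (P n ν x))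
    (hCne : ∀ n ν x, (C n ν x).Nonempty)
    (hI : ∀ n ν, {x : (μ : N) → X μ | (C n ν x ∩ P n ν x).Nonempty} = I ν)
    (hreg : ∀ n ν x, (C n ν x ∩ P n ν x).Nonempty → ∀ ε : ℝ, 0 < ε →
      Metric.thickening ε (C n ν x) ∩ Metric.thickening ε (P n ν x) ⊆
        Metric.thickening (a * ε) (C n ν x ∩ P n ν x))
    -- ĝ is an abstract economy profile satisfying (A1), (A2), (A3), (Ψ2)
    (hChatsub : ∀ ν x, Chat ν x ⊆ X ν) (hPhatsub : ∀ ν x, Phat ν x ⊆ X ν)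
    (hChatdep : ∀ ν x y, (∀ μ, μ ≠ ν → x μ = y μ) → Chat ν x = Chat ν y)
    (hChatusc : ∀ ν, UpperSemicontinuousSV (Chat ν))
    (hPhatusc : ∀ ν, UpperSemicontinuousSV (Phat ν))
    (hChatcp : ∀ ν x, IsCompact (Chat ν x)) (hChatcv : ∀ ν x, Convex ℝ (Chat ν x))
    (hPhatcp : ∀ ν x, IsCompact (Phat ν x)) (hPhatcv : ∀ ν x, Convex ℝ (Phat ν x))
    (hChatne : ∀ ν x, (Chat ν x).Nonempty)
    (hIhat : ∀ ν, {x : (μ : N) → X μ | (Chat ν x ∩ Phat ν x).Nonempty} = I ν)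
    (hreghat : ∀ ν x, (Chat ν x ∩ Phat ν x).Nonempty → ∀ ε : ℝ, 0 < ε →
      Metric.thickening ε (Chat ν x) ∩ Metric.thickening ε (Phat ν x) ⊆
        Metric.thickening (a * ε) (Chat ν x ∩ Phat ν x))
    -- convergence of the profiles
    (hρ : Tendsto (fun n => rho (C n) Chat (P n) Phat) atTop (𝓝 0)) :
    ∀ (x : ℕ → ((μ : N) → X μ)) (xhat : (μ : N) → X μ),
      Tendsto x atTop (𝓝 xhat) →
      gapFun Chat Phat xhat ≤ liminf (fun n => gapFun (C n) (P n) (x n)) atTop := by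
  intro x xhat hx
  have hle : ∀ n ν,
      (⨆ y, Metric.hausdorffEDist (C n ν y) (Chat ν y)) +
        (⨆ y, Metric.hausdorffEDist (P n ν y) (Phat ν y)) ≤ rho (C n) Chat (P n) Phat :=
    fun n ν => Finset.single_le_sum
      (f := fun ν => (⨆ y, Metric.hausdorffEDist (C n ν y) (Chat ν y)) +
        (⨆ y, Metric.hausdorffEDist (P n ν y) (Phat ν y)))
      (fun _ _ => zero_le) (Finset.mem_univ ν)
  have hCt : ∀ ν, Tendsto (fun n => ⨆ y, Metric.hausdorffEDist (C n ν y) (Chat ν y))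
      atTop (𝓝 0) := fun ν =>
    tendsto_of_tendsto_of_tendsto_of_le_of_le tendsto_const_nhds hρ (fun _ => zero_le)
      fun n => le_self_add.trans (hle n ν)
  have hPt : ∀ ν, Tendsto (fun n => ⨆ y, Metric.hausdorffEDist (P n ν y) (Phat ν y))
      atTop (𝓝 0) := fun ν =>
    tendsto_of_tendsto_of_tendsto_of_le_of_le tendsto_const_nhds hρ (fun _ => zero_le)
      fun n => le_add_self.trans (hle n ν)
  have hG : ∀ ν, ∀ ε : ℝ, 0 < ε → ∀ᶠ n in atTop,
      Gmap (C n ν) (P n ν) (x n) ⊆ Metric.thickening ε (Gmap (Chat ν) (Phat ν) xhat) := by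
    intro ν ε hε
    by_cases hxI : (Chat ν xhat ∩ Phat ν xhat).Nonempty
    · have hmem : xhat ∈ I ν := by rw [← hIhat ν]; exact hxI
      have hδ : 0 < ε / a := div_pos hε ha
      filter_upwards [hx.eventually ((hIopen ν).mem_nhds hmem),
        (hChatusc ν).eventually_subset_thickening (hCt ν) hx hδ,
        (hPhatusc ν).eventually_subset_thickening (hPt ν) hx hδ] with n hn hCn hPn
      have hn' : (C n ν (x n) ∩ P n ν (x n)).Nonempty := by
        rw [← hI n ν] at hn; exact hn
      have hsub := (inter_subset_inter hCn hPn).trans (hreghat ν xhat hxI _ hδ)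
      rw [mul_div_cancel₀ ε ha.ne'] at hsub
      simpa only [Gmap, if_pos hxI, if_pos hn'] using hsub
    · filter_upwards [(hChatusc ν).eventually_subset_thickening (hCt ν) hx hε] with n hn
      have hsub := (Gmap_subset (C n ν) (P n ν) (x n)).trans hn
      simpa only [Gmap, if_neg hxI] using hsub
  have hbdd : ∀ n, gapFun (C n) (P n) (x n) ≤ ∑ ν, Metric.diam (X ν) := by
    intro n
    refine ciSup_le fun ν => ?_
    obtain ⟨z, hz⟩ := Gmap_nonempty (P n ν) (hCne n ν (x n))
    calc Metric.infDist (x n ν : E ν) (Gmap (C n ν) (P n ν) (x n))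
        ≤ dist (x n ν : E ν) z := Metric.infDist_le_dist_of_mem hz
      _ ≤ Metric.diam (X ν) := Metric.dist_le_diam_of_mem (hXcp ν).isBounded (x n ν).2
          (hCsub n ν _ (Gmap_subset _ _ _ hz))
      _ ≤ ∑ ν, Metric.diam (X ν) := Finset.single_le_sum (f := fun ν => Metric.diam (X ν))
          (fun _ _ => Metric.diam_nonneg) (Finset.mem_univ ν)
  have hcob : IsCoboundedUnder (· ≥ ·) atTop fun n => gapFun (C n) (P n) (x n) :=
    (isBoundedUnder_of ⟨_, hbdd⟩ : IsBoundedUnder (· ≤ ·) atTop _).isCoboundedUnder_ge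
  refine le_of_forall_sub_le fun ε hε => le_liminf_of_le hcob ?_
  have hdist : ∀ ν, ∀ᶠ n in atTop, dist (xhat ν : E ν) (x n ν) < ε / 2 := fun ν => by
    have h := Metric.tendsto_nhds.1 (tendsto_pi_nhds.1 hx ν) _ (half_pos hε)
    filter_upwards [h] with n hn
    rwa [dist_comm, ← Subtype.dist_eq]
  filter_upwards [eventually_all.2 hdist,
    eventually_all.2 fun ν => hG ν (ε / 2) (half_pos hε)] with n hn₁ hn₂
  rw [sub_le_iff_le_add]
  refine ciSup_le fun ν => ?_
  have h₁ := infDist_le_of_subset_thickening (Gmap_nonempty (P n ν) (hCne n ν (x n))) (hn₂ ν)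
    (xhat ν : E ν) (x n ν)
  have h₂ : Metric.infDist (x n ν : E ν) (Gmap (C n ν) (P n ν) (x n)) ≤
      gapFun (C n) (P n) (x n) :=
    le_ciSup (f := fun ν => Metric.infDist (x n ν : E ν) (Gmap (C n ν) (P n ν) (x n)))
      (finite_range _).bddAbove ν
  linarith [hn₁ ν]
end

section
/- Let Λ be a compact metric space and Λ_ad ⊆ Λ a nonempty closed set, and let F : Λ × X → ℝ be lower semicontinuous. Fix open sets I_ν ⊆ X (ν ∈ N) and constants τ > 0, α > 0. For each t ∈ Λ let g(t) = (C_ν(t,·), P_ν(t,·))_{ν∈N} be an abstract economy profile satisfying: (A1) upper semicontinuous constraint and preference maps with compact convex values; (A2) nonempty-valued constraint maps; (A3) with common improvement sets {x ∈ X : C_ν(t,x) ∩ P_ν(t,x) ≠ ∅} = I_ν for every ν (independent of t); (Ψ1) with the common constant τ: x_ν ∈ C_ν(t,x) implies d(x_ν, p) ≥ τ for every p ∈ P_ν(t,x); and (Ψ2) with the common constant α. Assume the map t ↦ g(t) is continuous with respect to ρ (for every t and ε > 0 there is a neighborhood V of t with ρ(g(t'), g(t)) < ε for all t' ∈ V).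 Then the single leader multi-follower game has a solution: there exist t̄ ∈ Λ_ad and x̄ ∈ NE(g(t̄)) such that F(t̄, x̄) ≤ F(t, x) for every t ∈ Λ_ad and every x ∈ NE(g(t)). -/
open Metric Set Filter Topology
open scoped ENNReal

open Classical in
/-- A surjection from an `n + 1`-element set onto an `n`-element set stays surjective after the
removal of exactly two of the elements. -/
theorem Finset.card_filter_image_erase_eq_two {α β : Type*} (f : α → β)
    {s : Finset α} {t : Finset β} (himg : s.image f = t) (hcard : s.card = t.card + 1) :
    (s.filter fun x => (s.erase x).image f = t).card = 2 := by
  obtain ⟨x, hx, y, hy, hxy, hfxy⟩ := Finset.exists_ne_map_eq_of_card_lt_of_maps_to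
    (by omega : t.card < s.card) (f := f)
    (fun x hx => himg ▸ Finset.mem_image_of_mem f (Finset.mem_coe.1 hx))
  have key : ∀ u ∈ s, ∀ v ∈ s, u ≠ v → f u = f v → (s.erase u).image f = t := by
    intro u hu v hv huv h
    rw [← himg]
    refine (Finset.image_subset_image (Finset.erase_subset _ _)).antisymm ?_
    intro b hb
    obtain ⟨w, hw, rfl⟩ := Finset.mem_image.1 hb
    by_cases hwu : w = u
    · exact Finset.mem_image.2 ⟨v, Finset.mem_erase.2 ⟨huv.symm, hv⟩, by rw [hwu, h]⟩
    · exact Finset.mem_image_of_mem f (Finset.mem_erase.2 ⟨hwu, hw⟩)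
  have hset : (s.filter fun x => (s.erase x).image f = t) = {x, y} := by
    ext z
    simp only [Finset.mem_filter, Finset.mem_insert, Finset.mem_singleton]
    constructor
    · rintro ⟨hz, hzt⟩
      by_contra! hne
      have hinj : Set.InjOn f (s.erase z : Finset α) := by
        apply Finset.injOn_of_card_image_eq
        rw [hzt, Finset.card_erase_of_mem hz]
        omega
      exact hxy (hinj (by simp [hx, hne.1.symm]) (by simp [hy, hne.2.symm]) hfxy)
    · rintro (rfl | rfl)
      · exact ⟨hx, key _ hx _ hy hxy hfxy⟩
      · exact ⟨hy, key _ hy _ hx hxy.symm hfxy.symm⟩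
  rw [hset, Finset.card_pair hxy]

/-- A finite set is dominant for a family of orders, given by ranks, if no point lies strictly
above all the minima of the set. -/
def IsDominant {I T : Type*} (r : I → T → ℕ) (σ : Finset T) : Prop :=
  ∀ y, ∃ i, ∀ x ∈ σ, r i y ≤ r i x

theorem IsDominant.mono {I T : Type*} {r : I → T → ℕ} {σ τ : Finset T}
    (h : IsDominant r σ) (hτ : τ ⊆ σ) : IsDominant r τ := fun y =>
  (h y).imp fun _ hi x hx => hi x (hτ hx)

open Classical in
/-- A nonempty dominant set of `|I| - 1` elements, such that for each `a` some point lies strictly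
above all its minima for the orders other than `a`, is contained in exactly two dominant sets of
`|I|` elements. -/
theorem IsDominant.card_cofaces {I T : Type*} [Fintype I] [Fintype T] {r : I → T → ℕ}
    (hr : ∀ i, Function.Injective (r i)) {τ : Finset T} (hτ : IsDominant r τ)
    (hcard : τ.card + 1 = Fintype.card I) (hne : τ.Nonempty)
    (hext : ∀ a, ∃ y, ∀ i, i ≠ a → ∃ x ∈ τ, r i x < r i y) :
    (Finset.univ.filter fun σ : Finset T =>
      (σ.card = Fintype.card I ∧ IsDominant r σ) ∧ τ ⊆ σ).card = 2 := by
  choose g hgτ hg using fun i => τ.exists_min_image (r i) hne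
  have himg : Finset.univ.image g = τ := by
    ext x
    simp only [Finset.mem_image, Finset.mem_univ, true_and]
    constructor
    · rintro ⟨i, rfl⟩; exact hgτ i
    · intro hx
      obtain ⟨i, hi⟩ := hτ x
      exact ⟨i, hr i ((hg i x hx).antisymm (hi _ (hgτ i)))⟩
  have hmax : ∀ a, ∃ m, (∀ i, i ≠ a → r i (g i) < r i m) ∧
      ∀ y, (∀ i, i ≠ a → r i (g i) < r i y) → r a y ≤ r a m := by
    intro a
    obtain ⟨m, hm, hm'⟩ := (Finset.univ.filter fun y : T =>
      ∀ i, i ≠ a → r i (g i) < r i y).exists_max_image (r a) (by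
        obtain ⟨y, hy⟩ := hext a
        refine ⟨y, Finset.mem_filter.2 ⟨Finset.mem_univ _, fun i hi => ?_⟩⟩
        obtain ⟨x, hx, hxy⟩ := hy i hi
        exact (hg i x hx).trans_lt hxy)
    exact ⟨m, (Finset.mem_filter.1 hm).2, fun y hy => hm' y (by simpa using hy)⟩
  choose m hm hm' using hmax
  rw [← Finset.card_filter_image_erase_eq_two g himg (by rw [Finset.card_univ, hcard])]
  symm
  have hnot : ∀ a, (Finset.univ.erase a).image g = τ → m a ∉ τ := by
    intro a ha hmem
    rw [← ha] at hmem
    obtain ⟨i, hi, hgi⟩ := Finset.mem_image.1 hmem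
    have := hm a i (Finset.ne_of_mem_erase hi)
    rw [hgi] at this
    exact this.false
  refine Finset.card_bij (fun a _ => insert (m a) τ) ?_ ?_ ?_
  · intro a ha
    have ha := (Finset.mem_filter.1 ha).2
    refine Finset.mem_filter.2 ⟨Finset.mem_univ _, ⟨?_, ?_⟩, Finset.subset_insert _ _⟩
    · rw [Finset.card_insert_of_notMem (hnot a ha), hcard]
    · intro y
      by_cases hy : ∀ i, i ≠ a → r i (g i) < r i y
      · refine ⟨a, fun x hx => ?_⟩
        obtain rfl | hxτ := Finset.mem_insert.1 hx
        · exact hm' a y hy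
        · obtain ⟨i, hi⟩ := hτ y
          obtain rfl | hia := eq_or_ne i a
          · exact hi x hxτ
          · exact absurd (hi _ (hgτ i)) (hy i hia).not_ge
      · push Not at hy
        obtain ⟨i, hia, hi⟩ := hy
        refine ⟨i, fun x hx => ?_⟩
        obtain rfl | hx := Finset.mem_insert.1 hx
        · exact hi.trans (hm a i hia).le
        · exact hi.trans (hg i x hx)
  · intro a ha b hb hab
    have ha := (Finset.mem_filter.1 ha).2
    have hb := (Finset.mem_filter.1 hb).2
    by_contra hne
    have hmem : m a = m b := by
      have : m a ∈ insert (m b) τ := hab ▸ Finset.mem_insert_self _ _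
      exact (Finset.mem_insert.1 this).resolve_right (hnot a ha)
    obtain ⟨i, hi⟩ := hτ (m a)
    have h1 := hi _ (hgτ i)
    obtain rfl | hia := eq_or_ne i a
    · have := hm b i hne
      rw [← hmem] at this
      omega
    · have := hm a i hia
      omega
  · intro σ hσ
    obtain ⟨-, ⟨hσc, hσd⟩, hsub⟩ := Finset.mem_filter.1 hσ
    obtain ⟨x, hxσ⟩ : ∃ x, σ \ τ = {x} := by
      rw [← Finset.card_eq_one, Finset.card_sdiff_of_subset hsub]; omega
    have hx : x ∈ σ ∧ x ∉ τ := Finset.mem_sdiff.1 (hxσ ▸ Finset.mem_singleton_self x)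
    have hσx : insert x τ = σ := by
      rw [Finset.insert_eq, ← hxσ, Finset.sdiff_union_of_subset hsub]
    choose k hk using hσd
    have hkinj : Set.InjOn k σ := by
      intro u hu v hv huv
      have h1 := hk u v hv
      have h2 := hk v u hu
      rw [← huv] at h2
      exact hr _ (h1.antisymm h2)
    have hkim : σ.image k = Finset.univ := by
      rw [← Finset.card_eq_iff_eq_univ, Finset.card_image_of_injOn hkinj, hσc]
    have hkg : ∀ y ∈ τ, g (k y) = y := fun y hy =>
      hr _ ((hg _ y hy).antisymm (hk y _ (hsub (hgτ _))))
    have hkne : ∀ y ∈ τ, k y ≠ k x := fun y hy h =>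
      hx.2 (hkinj (hsub hy) hx.1 h ▸ hy)
    have hgx : ∀ i, i ≠ k x → r i (g i) < r i x := by
      intro i hi
      obtain ⟨y, hy, rfl⟩ := Finset.mem_image.1 (hkim ▸ Finset.mem_univ i)
      have hyx : y ≠ x := fun h => hi (h ▸ rfl)
      have hyτ : y ∈ τ := by
        rw [← hσx] at hy
        exact (Finset.mem_insert.1 hy).resolve_left hyx
      rw [hkg y hyτ]
      exact lt_of_le_of_ne (hk y x hx.1) fun h => hyx (hr _ h)
    refine ⟨k x, Finset.mem_filter.2 ⟨Finset.mem_univ _, ?_⟩, ?_⟩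
    · refine Finset.Subset.antisymm ?_ fun y hy => ?_
      · exact fun z hz => himg ▸ Finset.image_subset_image (Finset.erase_subset _ _) hz
      · exact Finset.mem_image.2 ⟨k y, by simp [hkne y hy], hkg y hy⟩
    · rw [← hσx]
      congr 1
      refine hr (k x) (le_antisymm ?_ (hm' _ x hgx))
      have h2 : k (m (k x)) = k x := by
        by_contra hne
        exact absurd (hk (m (k x)) _ (hsub (hgτ _))) (hm (k x) _ hne).not_ge
      have := hk (m (k x)) x hx.1
      rwa [h2] at this

open Classical in
/-- A set of `|I|` elements whose colours are not all of `I` has an even number of facets carrying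
all colours but `i₀`. -/
theorem even_card_facets_image_eq_erase {I T : Type*} [Fintype I] [Fintype T] (c : T → I)
    {σ : Finset T} (hcard : σ.card = Fintype.card I) (hc : σ.image c ≠ Finset.univ) (i₀ : I) :
    Even (Finset.univ.filter fun τ : Finset T =>
      (τ.card + 1 = Fintype.card I ∧ τ.image c = Finset.univ.erase i₀) ∧ τ ⊆ σ).card := by
  by_cases h : σ.image c = Finset.univ.erase i₀
  · have hpos : 0 < Fintype.card I := Fintype.card_pos_iff.2 ⟨i₀⟩
    have h2 := Finset.card_filter_image_erase_eq_two c h (by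
      rw [Finset.card_erase_of_mem (Finset.mem_univ _), Finset.card_univ]; omega)
    have himg : (Finset.univ.filter fun τ : Finset T =>
        (τ.card + 1 = Fintype.card I ∧ τ.image c = Finset.univ.erase i₀) ∧ τ ⊆ σ) =
        (σ.filter fun x => (σ.erase x).image c = Finset.univ.erase i₀).image σ.erase := by
      ext τ
      simp only [Finset.mem_filter, Finset.mem_univ, true_and, Finset.mem_image]
      constructor
      · rintro ⟨⟨hτ, hτc⟩, hsub⟩
        obtain ⟨x, hxσ⟩ : ∃ x, σ \ τ = {x} := by
          rw [← Finset.card_eq_one, Finset.card_sdiff_of_subset hsub]; omega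
        have hx : x ∈ σ := (Finset.mem_sdiff.1 (hxσ ▸ Finset.mem_singleton_self x)).1
        have : σ.erase x = τ := by
          rw [Finset.erase_eq, ← hxσ, Finset.sdiff_sdiff_eq_self hsub]
        exact ⟨x, ⟨hx, by rw [this, hτc]⟩, this⟩
      · rintro ⟨x, ⟨hx, hxc⟩, rfl⟩
        exact ⟨⟨by rw [Finset.card_erase_of_mem hx]; omega, hxc⟩, Finset.erase_subset _ _⟩
    rw [himg, Finset.card_image_of_injOn, h2]
    · exact even_two
    · exact σ.erase_injOn.mono fun x hx => (Finset.mem_filter.1 hx).1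
  · refine (congrArg Even (Finset.card_eq_zero.2 (Finset.filter_eq_empty_iff.2 ?_))).mpr Even.zero
    rintro τ - ⟨⟨-, hτ⟩, hsub⟩
    have hsup : Finset.univ.erase i₀ ⊆ σ.image c := hτ ▸ Finset.image_subset_image hsub
    by_cases hi : i₀ ∈ σ.image c
    · refine hc (Finset.eq_univ_iff_forall.2 fun i => ?_)
      obtain rfl | hne := eq_or_ne i i₀
      · exact hi
      · exact hsup (by simp [hne])
    · exact h (Finset.Subset.antisymm (fun i hi' =>
        Finset.mem_erase.2 ⟨fun e => hi (e ▸ hi'), Finset.mem_univ _⟩) hsup)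

open Classical in
/-- **Scarf's lemma**: with slack elements `s i`, least for the order `i` and above every other
element for the remaining orders, every colouring extending `s i ↦ i` has a dominant set of `|I|`
elements bearing all the colours. -/
theorem exists_isDominant_image_eq_univ {I T : Type*} [Fintype I] [Nonempty I] [Fintype T]
    {r : I → T → ℕ} (hr : ∀ i, Function.Injective (r i)) (s : I → T)
    (hmin : ∀ i y, r i (s i) ≤ r i y)
    (hslack : ∀ i j y, j ≠ i → y ∉ Set.range s → r i y < r i (s j))
    (c : T → I) (hc : ∀ i, c (s i) = i) :
    ∃ σ : Finset T, IsDominant r σ ∧ σ.image c = Finset.univ := by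
  by_contra! hno
  obtain ⟨i₀⟩ := ‹Nonempty I›
  have hpos : 0 < Fintype.card I := Fintype.card_pos_iff.2 ⟨i₀⟩
  have hsinj : Function.Injective s := Function.LeftInverse.injective hc
  set rooms := Finset.univ.filter fun σ : Finset T => σ.card = Fintype.card I ∧ IsDominant r σ
    with hrooms
  set doors := Finset.univ.filter fun τ : Finset T =>
    (τ.card + 1 = Fintype.card I ∧ IsDominant r τ) ∧ τ.image c = Finset.univ.erase i₀ with hdoors
  set τ₀ := (Finset.univ.erase i₀).image s with hτ₀
  have hτ₀mem : ∀ y, y ∈ τ₀ ↔ ∃ i, i ≠ i₀ ∧ s i = y := by simp [hτ₀]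
  have hτ₀card : τ₀.card + 1 = Fintype.card I := by
    rw [hτ₀, Finset.card_image_of_injective _ hsinj, Finset.card_erase_of_mem (Finset.mem_univ _),
      Finset.card_univ]
    omega
  have hbase : ∀ m, (∀ y ∉ τ₀, r i₀ y ≤ r i₀ m) → IsDominant r (insert m τ₀) := by
    intro m hm y
    by_cases hy : y ∈ τ₀
    · obtain ⟨i, -, rfl⟩ := (hτ₀mem y).1 hy
      exact ⟨i, fun x _ => hmin i x⟩
    · refine ⟨i₀, fun x hx => ?_⟩
      obtain rfl | hx := Finset.mem_insert.1 hx
      · exact hm y hy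
      · obtain ⟨j, hj, rfl⟩ := (hτ₀mem x).1 hx
        by_cases hys : y ∈ Set.range s
        · obtain ⟨k, rfl⟩ := hys
          obtain rfl : k = i₀ := by
            by_contra hk
            exact hy ((hτ₀mem _).2 ⟨k, hk, rfl⟩)
          exact hmin _ _
        · exact (hslack i₀ j y hj hys).le
  have hs₀ : s i₀ ∉ τ₀ := fun h => by
    obtain ⟨i, hi, h⟩ := (hτ₀mem _).1 h
    exact hi (hsinj h)
  obtain ⟨m, hm, hmmax⟩ := (Finset.univ.filter (· ∉ τ₀)).exists_max_image (r i₀)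
    ⟨s i₀, by simpa using hs₀⟩
  replace hm : m ∉ τ₀ := by simpa using hm
  replace hmmax : ∀ y ∉ τ₀, r i₀ y ≤ r i₀ m := fun y hy => hmmax y (by simpa using hy)
  have hτ₀door : τ₀ ∈ doors := by
    refine Finset.mem_filter.2 ⟨Finset.mem_univ _,
      ⟨hτ₀card, (hbase m hmmax).mono (Finset.subset_insert _ _)⟩, ?_⟩
    rw [hτ₀, Finset.image_image]
    rw [show c ∘ s = id from funext hc, Finset.image_id]
  have hone : (rooms.filter fun σ => τ₀ ⊆ σ).card = 1 := by
    refine Finset.card_eq_one.2 ⟨insert m τ₀, ?_⟩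
    ext σ
    simp only [hrooms, Finset.mem_filter, Finset.mem_univ, true_and, Finset.mem_singleton]
    constructor
    · rintro ⟨⟨hσc, hσd⟩, hsub⟩
      obtain ⟨x, hxσ⟩ : ∃ x, σ \ τ₀ = {x} := by
        rw [← Finset.card_eq_one, Finset.card_sdiff_of_subset hsub]; omega
      have hx : x ∈ σ ∧ x ∉ τ₀ := Finset.mem_sdiff.1 (hxσ ▸ Finset.mem_singleton_self x)
      have hσx : insert x τ₀ = σ := by
        rw [Finset.insert_eq, ← hxσ, Finset.sdiff_union_of_subset hsub]
      rw [← hσx]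
      congr 1
      obtain ⟨i, hi⟩ := hσd m
      obtain rfl : i = i₀ := by
        by_contra hne
        have hsi : s i ∈ τ₀ := (hτ₀mem _).2 ⟨i, hne, rfl⟩
        exact hm (hr i ((hmin i m).antisymm (hi _ (hsub hsi))) ▸ hsi)
      exact hr i ((hmmax x hx.2).antisymm (hi x hx.1))
    · rintro rfl
      exact ⟨⟨by rw [Finset.card_insert_of_notMem hm, hτ₀card], hbase m hmmax⟩,
        Finset.subset_insert _ _⟩
  have htwo : ∀ τ ∈ doors.erase τ₀, (rooms.filter fun σ => τ ⊆ σ).card = 2 := by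
    intro τ hτ
    obtain ⟨hne, hτ⟩ := Finset.mem_erase.1 hτ
    obtain ⟨-, ⟨hτc, hτd⟩, hτi⟩ := Finset.mem_filter.1 hτ
    obtain ⟨x, hx, hxs⟩ : ∃ x ∈ τ, x ∉ Set.range s := by
      by_contra! hall
      refine hne (Finset.eq_of_subset_of_card_le (fun x hx => ?_) (by omega))
      obtain ⟨i, rfl⟩ := hall x hx
      refine (hτ₀mem _).2 ⟨i, fun h => ?_, rfl⟩
      have : c (s i) ∈ Finset.univ.erase i₀ := hτi ▸ Finset.mem_image_of_mem c hx
      rw [hc] at this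
      exact Finset.ne_of_mem_erase this h
    rw [hrooms, Finset.filter_filter]
    exact hτd.card_cofaces hr hτc ⟨x, hx⟩ fun a =>
      ⟨s a, fun i hi => ⟨x, hx, hslack i a x hi.symm hxs⟩⟩
  have heven : ∀ σ ∈ rooms, Even (doors.filter fun τ => τ ⊆ σ).card := by
    intro σ hσ
    obtain ⟨-, hσc, hσd⟩ := Finset.mem_filter.1 hσ
    convert even_card_facets_image_eq_erase c hσc (hno σ hσd) i₀ using 2
    ext τ
    simp only [hdoors, Finset.mem_filter, Finset.mem_univ, true_and]
    exact ⟨fun h => ⟨⟨h.1.1.1, h.1.2⟩, h.2⟩,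
      fun h => ⟨⟨⟨h.1.1, hσd.mono h.2⟩, h.1.2⟩, h.2⟩⟩
  have hdouble := Finset.sum_card_bipartiteAbove_eq_sum_card_bipartiteBelow
    (s := doors) (t := rooms) (fun τ σ => τ ⊆ σ)
  simp only [Finset.bipartiteAbove, Finset.bipartiteBelow] at hdouble
  rw [← Finset.add_sum_erase _ _ hτ₀door, hone, Finset.sum_congr rfl htwo, Finset.sum_const,
    smul_eq_mul] at hdouble
  have := Finset.even_sum _ heven
  rw [← hdouble] at this
  grind

open Classical in
/-- For every colouring of the grid points of a dilated simplex there is a grid point which, for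
each coordinate, is either small in it or close to a point with that colour. -/
theorem exists_grid_point_near_colors {I : Type*} [Fintype I] [Nonempty I] (m : ℕ)
    (c : (I → ℕ) → I) :
    ∃ z : I → ℕ, ∑ i, z i = m ∧ ∀ i, z i ≤ Fintype.card I ∨
      ∃ x : I → ℕ, ∑ j, x j = m ∧ c x = i ∧
        ∀ j, x j ≤ z j + Fintype.card I ∧ z j ≤ x j + Fintype.card I := by
  let G := {x // x ∈ Finset.piAntidiag (Finset.univ : Finset I) m}
  have hG : ∀ x : G, ∑ i, x.1 i = m := fun x => (Finset.mem_piAntidiag.1 x.2).1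
  let K := Fintype.card (G ⊕ I)
  let e := Fintype.equivFin (G ⊕ I)
  let l : I → G ⊕ I → ℕ := fun i => Sum.elim (fun x => x.1 i + 1) fun j => if j = i then 0 else m + 2
  let r : I → G ⊕ I → ℕ := fun i y => l i y * K + e y
  have hlt : ∀ i y y', l i y < l i y' → r i y < r i y' := fun i y y' h => by
    have h1 : (e y : ℕ) < K := (e y).2
    have h2 : (l i y + 1) * K ≤ l i y' * K := Nat.mul_le_mul_right _ h
    change l i y * K + e y < l i y' * K + e y'
    linarith
  have hle : ∀ i y y', r i y ≤ r i y' → l i y ≤ l i y' := fun i y y' h =>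
    not_lt.1 fun h' => (hlt i _ _ h').not_ge h
  have hr : ∀ i, Function.Injective (r i) := fun i y y' h => by
    have h1 : l i y = l i y' := (hle i _ _ h.le).antisymm (hle i _ _ h.ge)
    have h2 : l i y * K + e y = l i y' * K + e y' := h
    rw [h1] at h2
    exact e.injective (Fin.ext (by omega))
  obtain ⟨σ, hσ, hσc⟩ := exists_isDominant_image_eq_univ hr Sum.inr
    (fun i y => by
      by_cases hy : y = Sum.inr i
      · rw [hy]
      · refine (hlt i _ _ ?_).le
        rcases y with x | j
        · simp [l]
        · have : j ≠ i := fun h => hy (h ▸ rfl)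
          simp [l, this])
    (fun i j y hji hy => by
      refine hlt i _ _ ?_
      rcases y with x | k
      · have : x.1 i ≤ m := (Finset.single_le_sum (f := x.1) (fun _ _ => Nat.zero_le _)
          (Finset.mem_univ i)).trans_eq (hG x)
        simp only [l, Sum.elim_inl, Sum.elim_inr, if_neg hji]
        omega
      · exact absurd ⟨k, rfl⟩ hy)
    (Sum.elim (fun x => c x.1) id) fun _ => rfl
  set C : Finset I := Finset.univ.filter fun i => Sum.inr i ∉ σ with hC
  have hdom : ∀ y : G, ∃ i ∈ C, ∀ x : G, Sum.inl x ∈ σ → y.1 i ≤ x.1 i := fun y => by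
    obtain ⟨i, hi⟩ := hσ (Sum.inl y)
    refine ⟨i, Finset.mem_filter.2 ⟨Finset.mem_univ _, fun h => ?_⟩, fun x hx => ?_⟩
    · simpa [l] using hle i _ _ (hi _ h)
    · simpa [l] using hle i _ _ (hi _ hx)
  have hcol : ∀ i ∈ C, ∃ x : G, Sum.inl x ∈ σ ∧ c x.1 = i := fun i hi => by
    obtain ⟨y, hy, hyi⟩ := Finset.mem_image.1 (hσc ▸ Finset.mem_univ i)
    rcases y with x | j
    · exact ⟨x, hy, hyi⟩
    · obtain rfl : j = i := hyi
      exact absurd hy (Finset.mem_filter.1 hi).2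
  obtain ⟨i₁, hi₁, -⟩ := hdom ⟨Pi.single (Classical.arbitrary I) m, by simp⟩
  obtain ⟨z, hz, -⟩ := hcol i₁ hi₁
  let R : Finset G := Finset.univ.filter fun x => Sum.inl x ∈ σ
  have hR : ∀ x : G, x ∈ R ↔ Sum.inl x ∈ σ := by simp [R]
  choose w hwR hw using fun i => R.exists_min_image (fun x => x.1 i) ⟨z, (hR z).2 hz⟩
  have hsum : m < ∑ i ∈ C, ((w i).1 i + 1) := by
    by_contra! hlt
    let y : I → ℕ := fun i => (if i ∈ C then (w i).1 i + 1 else 0) +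
      if i = i₁ then m - ∑ i ∈ C, ((w i).1 i + 1) else 0
    have hy : ∑ i, y i = m := by
      simp only [y, Finset.sum_add_distrib, Finset.sum_ite_mem, Finset.univ_inter,
        Finset.sum_ite_eq', Finset.mem_univ, if_true] at hlt ⊢
      omega
    obtain ⟨i, hi, h⟩ := hdom ⟨y, by simp [hy]⟩
    have := h _ ((hR _).1 (hwR i))
    simp only [y, if_pos hi] at this
    omega
  have hCcard : C.card ≤ Fintype.card I := Finset.card_le_univ C
  rw [Finset.sum_add_distrib, Finset.sum_const, smul_eq_mul, mul_one] at hsum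
  have hbound : ∀ x ∈ R, ∀ j, x.1 j ≤ (if j ∈ C then (w j).1 j else 0) + Fintype.card I := by
    intro x hx j
    have h1 := hG x
    rw [← Finset.add_sum_erase _ _ (Finset.mem_univ j)] at h1
    have h2 : ∑ i ∈ C.erase j, (w i).1 i ≤ ∑ i ∈ Finset.univ.erase j, x.1 i :=
      (Finset.sum_le_sum fun i _ => hw i x hx).trans
        (Finset.sum_le_sum_of_subset (Finset.erase_subset_erase _ (Finset.subset_univ _)))
    split_ifs with hj
    · have h3 := Finset.add_sum_erase C (fun i => (w i).1 i) hj
      omega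
    · rw [Finset.erase_eq_of_notMem hj] at h2
      omega
  have hlow : ∀ x ∈ R, ∀ j, (if j ∈ C then (w j).1 j else 0) ≤ x.1 j := fun x hx j => by
    split_ifs
    · exact hw j x hx
    · exact Nat.zero_le _
  refine ⟨z.1, hG z, fun i => ?_⟩
  by_cases hi : i ∈ C
  · obtain ⟨x, hx, hxi⟩ := hcol i hi
    rw [← hR] at hx hz
    refine Or.inr ⟨x.1, hG x, hxi, fun j => ?_⟩
    have := hbound x hx j
    have := hbound z hz j
    have := hlow x hx j
    have := hlow z hz j
    omega
  · left
    simpa [hi] using hbound z ((hR z).2 hz) i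

/-- **Brouwer's fixed point theorem** for the standard simplex. -/
theorem exists_fixedPoint_stdSimplex {I : Type*} [Fintype I] [Nonempty I]
    (f : stdSimplex ℝ I → stdSimplex ℝ I) (hf : Continuous f) : ∃ x, f x = x := by
  have hcpt : CompactSpace (stdSimplex ℝ I) := isCompact_iff_compactSpace.1 (isCompact_stdSimplex ℝ I)
  have approx : ∀ ε > 0, ∃ z : stdSimplex ℝ I, ∀ i, z.1 i - (f z).1 i ≤ ε := by
    intro ε hε
    obtain ⟨δ, hδ, hfδ⟩ := Metric.uniformContinuous_iff.1
      (CompactSpace.uniformContinuous_of_continuous hf) (ε / 2) (half_pos hε)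
    obtain ⟨m, hm⟩ := exists_nat_gt (Fintype.card I / min δ (ε / 2))
    have hmin : 0 < min δ (ε / 2) := lt_min hδ (half_pos hε)
    have hm0 : (0 : ℝ) < m := lt_of_le_of_lt (by positivity) hm
    have hsmall : Fintype.card I / (m : ℝ) < min δ (ε / 2) := by
      rw [div_lt_iff₀ hmin] at hm
      rw [div_lt_iff₀ hm0]
      linarith
    let p : ∀ x : I → ℕ, ∑ i, x i = m → stdSimplex ℝ I := fun x hx =>
      ⟨fun i => x i / m, fun i => by positivity, by
        rw [← Finset.sum_div, ← Nat.cast_sum, hx, div_self hm0.ne']⟩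
    have hcol : ∀ x : I → ℕ, ∃ i, ∀ hx : ∑ i, x i = m, (p x hx).1 i ≤ (f (p x hx)).1 i := by
      intro x
      by_cases hx : ∑ i, x i = m
      · obtain ⟨i, -, hi⟩ := Finset.exists_le_of_sum_le (s := Finset.univ)
          Finset.univ_nonempty ((p x hx).2.2.trans (f (p x hx)).2.2.symm).le
        exact ⟨i, fun _ => hi⟩
      · exact ⟨Classical.arbitrary I, fun h => absurd h hx⟩
    choose c hc using hcol
    obtain ⟨z, hz, hzc⟩ := exists_grid_point_near_colors m c
    refine ⟨p z hz, fun i => ?_⟩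
    rcases hzc i with hi | ⟨x, hx, rfl, hxz⟩
    · have h1 : (p z hz).1 i ≤ Fintype.card I / (m : ℝ) := by
        change (z i : ℝ) / m ≤ _
        gcongr
      have h2 := (f (p z hz)).2.1 i
      have := min_le_right δ (ε / 2)
      linarith
    · have hcoord : ∀ j, |(p x hx).1 j - (p z hz).1 j| ≤ Fintype.card I / (m : ℝ) := by
        intro j
        change |(x j : ℝ) / m - z j / m| ≤ _
        rw [← sub_div, abs_div, abs_of_pos hm0]
        gcongr
        obtain ⟨h1, h2⟩ := hxz j
        rw [abs_sub_le_iff]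
        constructor
        · rw [sub_le_iff_le_add']; exact_mod_cast h1
        · rw [sub_le_iff_le_add']; exact_mod_cast h2
      have hd : dist (p x hx) (p z hz) < δ := by
        refine lt_of_le_of_lt ?_ (hsmall.trans_le (min_le_left _ _))
        exact (dist_pi_le_iff (by positivity)).2 hcoord
      have h1 := (dist_le_pi_dist (f (p x hx)).1 (f (p z hz)).1 (c x)).trans_lt (hfδ hd)
      have h2 := hcoord (c x)
      have h3 := hc x hx
      rw [Real.dist_eq, abs_lt] at h1
      rw [abs_le] at h2
      have := min_le_right δ (ε / 2)
      linarith
  let F : stdSimplex ℝ I → ℝ := fun z =>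
    Finset.univ.sup' Finset.univ_nonempty fun i => z.1 i - (f z).1 i
  have hF : Continuous F := Continuous.finset_sup'_apply _ fun i _ =>
    ((continuous_apply i).comp continuous_subtype_val).sub
      ((continuous_apply i).comp (continuous_subtype_val.comp hf))
  obtain ⟨x, -, hx⟩ := isCompact_univ.exists_isMinOn univ_nonempty hF.continuousOn
  have hle : ∀ i ∈ Finset.univ, x.1 i ≤ (f x).1 i := fun i _ => by
    refine sub_nonpos.1 (le_of_forall_pos_le_add fun ε hε => ?_)
    obtain ⟨z, hz⟩ := approx ε hε
    rw [zero_add]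
    exact (Finset.le_sup' (fun i => x.1 i - (f x).1 i) (Finset.mem_univ i)).trans
      ((hx (mem_univ z)).trans (Finset.sup'_le _ _ fun i _ => hz i))
  refine ⟨x, Subtype.ext (funext fun i => ?_)⟩
  exact ((Finset.sum_eq_sum_iff_of_le hle).1 (x.2.2.trans (f x).2.2.symm) i (Finset.mem_univ i)).symm

/-- Approximate form of **Kakutani's fixed point theorem**, for an arbitrary set-valued map. -/
theorem exists_mem_convexHull_image_ball {E Y : Type*} [NormedAddCommGroup E] [NormedSpace ℝ E]
    [MetricSpace Y] [CompactSpace Y] [Nonempty Y] {ι : Y → E} (hι : IsEmbedding ι)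
    (hconv : Convex ℝ (range ι)) (B : Y → Set E) (hne : ∀ y, (B y).Nonempty)
    (hsub : ∀ y, B y ⊆ range ι) {δ : ℝ} (hδ : 0 < δ) :
    ∃ y, ι y ∈ convexHull ℝ (⋃ y' ∈ ball y δ, B y') := by
  obtain ⟨t, -, ht⟩ := isCompact_univ.elim_finite_subcover_image (b := univ)
    (c := fun y : Y => ball y δ) (fun _ _ => isOpen_ball)
    (fun y _ => mem_biUnion (mem_univ y) (mem_ball_self hδ))
  obtain ⟨htfin, hcover⟩ := ht
  have := htfin.fintype
  have hcov : ∀ y : Y, ∃ k : t, dist y k < δ := fun y => by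
    obtain ⟨k, hk, hy⟩ := mem_iUnion₂.1 (hcover (mem_univ y))
    exact ⟨⟨k, hk⟩, hy⟩
  have : Nonempty t := ⟨(hcov (Classical.arbitrary Y)).choose⟩
  choose b hb using hne
  let φ : t → Y → ℝ := fun k y => max 0 (δ - dist y k)
  have hφc : ∀ k, Continuous (φ k) := fun k => by fun_prop
  have hφ0 : ∀ k y, 0 ≤ φ k y := fun k y => le_max_left _ _
  have hφpos : ∀ y : Y, 0 < ∑ k, φ k y := fun y => by
    obtain ⟨k, hk⟩ := hcov y
    exact Finset.sum_pos' (fun k _ => hφ0 k y)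
      ⟨k, Finset.mem_univ _, lt_max_of_lt_right (sub_pos.2 hk)⟩
  let Φ : Y → stdSimplex ℝ t := fun y => ⟨fun k => φ k y / ∑ k, φ k y,
    fun k => div_nonneg (hφ0 k y) (hφpos y).le, by
      rw [← Finset.sum_div, div_self (hφpos y).ne']⟩
  have hΦ : Continuous Φ := Continuous.subtype_mk (continuous_pi fun k =>
    (hφc k).div (continuous_finsetSum _ fun k _ => hφc k) fun y => (hφpos y).ne') _
  have hmem : ∀ w : stdSimplex ℝ t, ∑ k, w.1 k • b k ∈ range ι := fun w =>
    hconv.sum_mem (fun k _ => w.2.1 k) w.2.2 fun k _ => hsub _ (hb k)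
  choose q hq using hmem
  have hqc : Continuous q := by
    rw [hι.continuous_iff, show ι ∘ q = fun w : stdSimplex ℝ t => ∑ k, w.1 k • b k from funext hq]
    exact continuous_finsetSum _ fun k _ =>
      ((continuous_apply k).comp continuous_subtype_val).smul continuous_const
  obtain ⟨w, hw⟩ := exists_fixedPoint_stdSimplex (Φ ∘ q) (hΦ.comp hqc)
  refine ⟨q w, ?_⟩
  rw [hq]
  have hz : ∀ k ∈ Finset.univ, w.1 k ≠ 0 → (b k : E) ∈ convexHull ℝ (⋃ y' ∈ ball (q w) δ, B y') := by
    intro k _ hk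
    refine subset_convexHull ℝ _ (mem_iUnion₂.2 ⟨k, ?_, hb k⟩)
    by_contra hfar
    refine hk ?_
    rw [mem_ball, dist_comm, not_lt] at hfar
    rw [← hw]
    change φ k (q w) / _ = 0
    rw [show φ k (q w) = 0 from max_eq_left (by linarith), zero_div]
  classical
  rw [← Finset.sum_filter_of_ne (p := fun k => w.1 k ≠ 0)
    (fun k _ h h0 => h (by rw [h0, zero_smul]))]
  refine (convex_convexHull ℝ _).sum_mem (fun k _ => w.2.1 k) ?_ fun k hk =>
    hz k (Finset.mem_univ _) (Finset.mem_filter.1 hk).2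
  rw [Finset.sum_filter_ne_zero]
  exact w.2.2

/-- **Kakutani–Fan–Glicksberg fixed point theorem** on a compact convex subset of a normed space,
given as the range of an embedding. -/
theorem exists_mem_of_eventually_subset_thickening {E Y : Type*} [NormedAddCommGroup E]
    [NormedSpace ℝ E] [MetricSpace Y] [CompactSpace Y] [Nonempty Y] {ι : Y → E}
    (hι : IsEmbedding ι) (hconv : Convex ℝ (range ι)) (B : Y → Set E)
    (hne : ∀ y, (B y).Nonempty) (hsub : ∀ y, B y ⊆ range ι) (hcv : ∀ y, Convex ℝ (B y))
    (hcl : ∀ y, IsClosed (B y))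
    (husc : ∀ y, ∀ ε > 0, ∀ᶠ y' in 𝓝 y, B y' ⊆ thickening ε (B y)) :
    ∃ y, ι y ∈ B y := by
  choose u hu using fun n : ℕ => exists_mem_convexHull_image_ball hι hconv B hne hsub
    (Nat.one_div_pos_of_nat (n := n) (α := ℝ))
  obtain ⟨y, -, ψ, hψ, hlim⟩ := isCompact_univ.tendsto_subseq (x := u) fun _ => mem_univ _
  refine ⟨y, ?_⟩
  rw [← (hcl y).closure_eq, closure_eq_iInter_cthickening]
  refine mem_iInter₂.2 fun ε hε => ?_
  refine isClosed_cthickening.mem_of_tendsto ((hι.continuous.tendsto y).comp hlim) ?_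
  obtain ⟨η, hη, hball⟩ := Metric.eventually_nhds_iff_ball.1 (husc y ε hε)
  have h1 : ∀ᶠ n in atTop, dist (u (ψ n)) y < η / 2 :=
    (tendsto_iff_dist_tendsto_zero.1 hlim).eventually (gt_mem_nhds (half_pos hη))
  have h2 : ∀ᶠ n in atTop, 1 / ((ψ n : ℝ) + 1) < η / 2 :=
    (tendsto_one_div_add_atTop_nhds_zero_nat.comp hψ.tendsto_atTop).eventually
      (gt_mem_nhds (half_pos hη))
  filter_upwards [h1, h2] with n hn hn'
  refine thickening_subset_cthickening _ _
    (convexHull_min (iUnion₂_subset fun y' hy' => hball y' ?_) ((hcv y).thickening ε) (hu (ψ n)))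
  rw [mem_ball] at hy' ⊢
  linarith [dist_triangle y' (u (ψ n)) y]

/-- The intersection of two upper semicontinuous compact-valued maps is upper semicontinuous. -/
theorem UpperSemicontinuousSV.inter {D Y : Type*} [TopologicalSpace D] [TopologicalSpace Y]
    [T2Space Y] {F G : D → Set Y} (hF : UpperSemicontinuousSV F) (hG : UpperSemicontinuousSV G)
    (hFc : ∀ x, IsCompact (F x)) (hGc : ∀ x, IsCompact (G x)) :
    UpperSemicontinuousSV fun x => F x ∩ G x := by
  intro x U hU hsub
  obtain ⟨V, W, hV, hW, hFV, hGW, hVW⟩ := SeparatedNhds.of_isCompact_isCompact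
    ((hFc x).diff hU) ((hGc x).diff hU) (disjoint_left.2 fun y hy hy' => hy.2 (hsub ⟨hy.1, hy'.1⟩))
  filter_upwards [hF x (U ∪ V) (hU.union hV) (sdiff_subset_iff.1 hFV),
    hG x (U ∪ W) (hU.union hW) (sdiff_subset_iff.1 hGW)] with x' h1 h2 y hy
  rcases h1 hy.1 with h | h
  · exact h
  · exact (h2 hy.2).resolve_right fun h' => disjoint_left.1 hVW h h'

/-- A generalized game whose improvement sets are open, and in which no player improves on a
feasible strategy by keeping it, has a Nash equilibrium. -/
theorem exists_nash_equilibrium {N : Type*} [Fintype N] {E : N → Type*}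
    [∀ ν, NormedAddCommGroup (E ν)] [∀ ν, NormedSpace ℝ (E ν)] (X : ∀ ν, Set (E ν))
    (hXne : ∀ ν, (X ν).Nonempty) (hXcp : ∀ ν, IsCompact (X ν)) (hXcv : ∀ ν, Convex ℝ (X ν))
    (C P : ∀ ν : N, ((μ : N) → X μ) → Set (E ν)) (hCsub : ∀ ν x, C ν x ⊆ X ν)
    (hCusc : ∀ ν, UpperSemicontinuousSV (C ν)) (hPusc : ∀ ν, UpperSemicontinuousSV (P ν))
    (hCcp : ∀ ν x, IsCompact (C ν x)) (hCcv : ∀ ν x, Convex ℝ (C ν x))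
    (hPcp : ∀ ν x, IsCompact (P ν x)) (hPcv : ∀ ν x, Convex ℝ (P ν x))
    (hCne : ∀ ν x, (C ν x).Nonempty)
    (hopen : ∀ ν, IsOpen {x | (C ν x ∩ P ν x).Nonempty})
    (hirr : ∀ ν (x : (μ : N) → X μ), (x ν : E ν) ∈ C ν x → (x ν : E ν) ∉ P ν x) :
    ∃ x : (μ : N) → X μ, ∀ ν, (x ν : E ν) ∈ C ν x ∧ C ν x ∩ P ν x = ∅ := by
  classical
  have : ∀ ν, CompactSpace (X ν) := fun ν => isCompact_iff_compactSpace.1 (hXcp ν)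
  have : ∀ ν, Nonempty (X ν) := fun ν => (hXne ν).to_subtype
  let B : ∀ ν : N, ((μ : N) → X μ) → Set (E ν) := fun ν x =>
    if (C ν x ∩ P ν x).Nonempty then C ν x ∩ P ν x else C ν x
  have hBC : ∀ ν x, B ν x ⊆ C ν x := fun ν x => by
    dsimp only [B]
    split_ifs
    · exact inter_subset_left
    · exact subset_rfl
  have hBne : ∀ ν x, (B ν x).Nonempty := fun ν x => by
    dsimp only [B]
    split_ifs with h
    · exact h
    · exact hCne ν x
  have hBcv : ∀ ν x, Convex ℝ (B ν x) := fun ν x => by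
    dsimp only [B]
    split_ifs
    · exact (hCcv ν x).inter (hPcv ν x)
    · exact hCcv ν x
  have hBcl : ∀ ν x, IsClosed (B ν x) := fun ν x => by
    dsimp only [B]
    split_ifs
    · exact (hCcp ν x).isClosed.inter (hPcp ν x).isClosed
    · exact (hCcp ν x).isClosed
  have hBusc : ∀ ν, UpperSemicontinuousSV (B ν) := by
    intro ν x U hU hsub
    by_cases h : (C ν x ∩ P ν x).Nonempty
    · rw [show B ν x = C ν x ∩ P ν x from if_pos h] at hsub
      filter_upwards [(hopen ν).mem_nhds h,
        (hCusc ν).inter (hPusc ν) (hCcp ν) (hPcp ν) x U hU hsub] with x' h1 h2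
      rwa [show B ν x' = C ν x' ∩ P ν x' from if_pos h1]
    · rw [show B ν x = C ν x from if_neg h] at hsub
      filter_upwards [hCusc ν x U hU hsub] with x' h'
      exact (hBC ν x').trans h'
  let ι : ((μ : N) → X μ) → ((μ : N) → E μ) := fun x μ => x μ
  have hι : Isometry ι := Isometry.of_dist_eq fun x y => rfl
  have hrange : range ι = univ.pi X := by
    ext v
    simp only [mem_range, mem_univ_pi]
    exact ⟨fun ⟨x, hx⟩ μ => hx ▸ (x μ).2, fun h => ⟨fun μ => ⟨v μ, h μ⟩, rfl⟩⟩
  obtain ⟨x, hx⟩ := exists_mem_of_eventually_subset_thickening hι.isEmbedding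
    (hrange ▸ convex_pi fun ν _ => hXcv ν) (fun x => univ.pi fun ν => B ν x)
    (fun x => univ_pi_nonempty_iff.2 fun ν => hBne ν x)
    (fun x => hrange ▸ pi_mono fun ν _ => (hBC ν x).trans (hCsub ν x))
    (fun x => convex_pi fun ν _ => hBcv ν x)
    (fun x => isClosed_set_pi fun ν _ => hBcl ν x)
    (fun x ε hε => by
      filter_upwards [eventually_all.2 fun ν => hBusc ν x _ isOpen_thickening
        (self_subset_thickening hε (B ν x))] with x' h v hv
      choose w hw hvw using fun ν => mem_thickening_iff.1 (h ν (hv ν (mem_univ ν)))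
      exact mem_thickening_iff.2 ⟨w, fun ν _ => hw ν, (dist_pi_lt_iff hε).2 hvw⟩)
  refine ⟨x, fun ν => ?_⟩
  have hxB : (x ν : E ν) ∈ B ν x := hx ν (mem_univ ν)
  refine ⟨hBC ν x hxB, not_nonempty_iff_eq_empty.1 fun h => ?_⟩
  rw [show B ν x = C ν x ∩ P ν x from if_pos h] at hxB
  exact hirr ν x hxB.1 hxB.2

/-- If `t ↦ C t` is continuous for the uniform Hausdorff distance and each `C t` is upper
semicontinuous with closed values, then `C` has closed graph. -/
theorem isClosed_setOf_mem_of_hausdorffEDist {Λ Y E : Type*} [TopologicalSpace Λ]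
    [TopologicalSpace Y] [NormedAddCommGroup E] {C : Λ → Y → Set E}
    (husc : ∀ t, UpperSemicontinuousSV (C t)) (hcl : ∀ t y, IsClosed (C t y))
    (hcont : ∀ t, ∀ ε > 0, ∀ᶠ t' in 𝓝 t, ∀ y, hausdorffEDist (C t' y) (C t y) < ε)
    {π : Y → E} (hπ : Continuous π) : IsClosed {p : Λ × Y | π p.2 ∈ C p.1 p.2} := by
  refine isClosed_iff_frequently.2 fun ⟨t, y⟩ hfreq => ?_
  change π y ∈ C t y
  rw [← (hcl t y).closure_eq, closure_eq_iInter_cthickening]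
  refine mem_iInter₂.2 fun ε hε => ?_
  have h1 : ∀ᶠ p : Λ × Y in 𝓝 (t, y), ∀ z, hausdorffEDist (C p.1 z) (C t z) <
      ENNReal.ofReal (ε / 2) :=
    (hcont t _ (ENNReal.ofReal_pos.2 (half_pos hε))).prod_inl_nhds y
  have h2 : ∀ᶠ p : Λ × Y in 𝓝 (t, y), C t p.2 ⊆ thickening (ε / 2) (C t y) :=
    (husc t y _ isOpen_thickening (self_subset_thickening (half_pos hε) _)).prod_inr_nhds t
  refine isClosed_cthickening.mem_of_frequently_of_tendsto (b := 𝓝 (t, y))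
    (f := fun p : Λ × Y => π p.2) ?_ (hπ.comp continuous_snd).continuousAt
  refine (hfreq.and_eventually (h1.and h2)).mono fun p hp => ?_
  obtain ⟨hp, hp1, hp2⟩ := hp
  replace hp : π p.2 ∈ C p.1 p.2 := hp
  obtain ⟨v, hv, hpv⟩ := exists_edist_lt_of_hausdorffEDist_lt hp (hp1 p.2)
  obtain ⟨w, hw, hvw⟩ := mem_thickening_iff.1 (hp2 hv)
  rw [edist_lt_ofReal] at hpv
  exact thickening_subset_cthickening _ _ (mem_thickening_iff.2
    ⟨w, hw, by linarith [dist_triangle (π p.2) v w]⟩)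

/-- existence of a solution to the single leader multi-follower game: the leader
minimizes a lower semicontinuous objective `F` over her closed nonempty admissible set `Λ_ad`
and the followers' Nash equilibria `NE(g(t))`, where `t ↦ g(t)` is `ρ`-continuous and each
profile `g(t)` satisfies (A1), (A2), (A3) with common improvement sets `I_ν`, (Ψ1) with common
constant `τ`, and (Ψ2) with common constant `α`. -/
theorem slmfg_existence
    {N : Type*} [Fintype N] [Nonempty N]
    {E : N → Type*} [∀ ν, NormedAddCommGroup (E ν)] [∀ ν, NormedSpace ℝ (E ν)]
    [∀ ν, CompleteSpace (E ν)]
    (X : ∀ ν, Set (E ν))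
    (hXne : ∀ ν, (X ν).Nonempty) (hXcp : ∀ ν, IsCompact (X ν)) (hXcv : ∀ ν, Convex ℝ (X ν))
    -- the leader's data
    {Λ : Type*} [MetricSpace Λ] [CompactSpace Λ]
    (Λad : Set Λ) (hΛad_ne : Λad.Nonempty) (hΛad_cl : IsClosed Λad)
    (F : Λ → ((μ : N) → X μ) → ℝ)
    (hF : LowerSemicontinuous (fun p : Λ × ((μ : N) → X μ) => F p.1 p.2))
    -- fixed open improvement sets and regularity constants
    (I : ∀ _ : N, Set ((μ : N) → X μ)) (hIopen : ∀ ν, IsOpen (I ν))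
    (τ : ℝ) (hτ : 0 < τ) (a : ℝ) (ha : 0 < a)
    -- the parametrized family of abstract economy profiles
    (C P : ∀ ν : N, Λ → ((μ : N) → X μ) → Set (E ν))
    (hCsub : ∀ ν t x, C ν t x ⊆ X ν) (hPsub : ∀ ν t x, P ν t x ⊆ X ν)
    (hCdep : ∀ ν t x y, (∀ μ, μ ≠ ν → x μ = y μ) → C ν t x = C ν t y)
    -- (A1)
    (hCusc : ∀ ν t, UpperSemicontinuousSV (C ν t))
    (hPusc : ∀ ν t, UpperSemicontinuousSV (P ν t))
    (hCcp : ∀ ν t x, IsCompact (C ν t x)) (hCcv : ∀ ν t x, Convex ℝ (C ν t x))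
    (hPcp : ∀ ν t x, IsCompact (P ν t x)) (hPcv : ∀ ν t x, Convex ℝ (P ν t x))
    -- (A2)
    (hCne : ∀ ν t x, (C ν t x).Nonempty)
    -- (A3) with common improvement sets, independent of `t`
    (hI : ∀ ν t, {x : (μ : N) → X μ | (C ν t x ∩ P ν t x).Nonempty} = I ν)
    -- (Ψ1) with the common constant `τ`
    (hΨ1 : ∀ ν t (x : (μ : N) → X μ), (x ν : E ν) ∈ C ν t x →
      ∀ p ∈ P ν t x, τ ≤ dist (x ν : E ν) p)
    -- (Ψ2) with the common constant `α`
    (hΨ2 : ∀ ν t x, (C ν t x ∩ P ν t x).Nonempty → ∀ ε : ℝ, 0 < ε →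
      Metric.thickening ε (C ν t x) ∩ Metric.thickening ε (P ν t x) ⊆
        Metric.thickening (a * ε) (C ν t x ∩ P ν t x))
    -- continuity of `t ↦ g(t)` with respect to `ρ`
    (hcont : ∀ t : Λ, ∀ ε : ℝ≥0∞, 0 < ε → ∃ V ∈ 𝓝 t, ∀ t' ∈ V,
      rho (fun ν => C ν t') (fun ν => C ν t) (fun ν => P ν t') (fun ν => P ν t) < ε) :
    ∃ tbar ∈ Λad, ∃ xbar : (μ : N) → X μ,
      (∀ ν, (xbar ν : E ν) ∈ C ν tbar xbar ∧ C ν tbar xbar ∩ P ν tbar xbar = ∅) ∧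
      ∀ t ∈ Λad, ∀ x : (μ : N) → X μ,
        (∀ ν, (x ν : E ν) ∈ C ν t x ∧ C ν t x ∩ P ν t x = ∅) →
        F tbar xbar ≤ F t x := by
  classical
  have : ∀ ν, CompactSpace (X ν) := fun ν => isCompact_iff_compactSpace.1 (hXcp ν)
  have hdisj : ∀ ν t x, C ν t x ∩ P ν t x = ∅ ↔ x ∉ I ν := fun ν t x => by
    rw [← hI ν t, mem_ofPred_eq, not_nonempty_iff_eq_empty]
  set S : Set (Λ × ((μ : N) → X μ)) :=
    {p | p.1 ∈ Λad ∧ ∀ ν, (p.2 ν : E ν) ∈ C ν p.1 p.2 ∧ C ν p.1 p.2 ∩ P ν p.1 p.2 = ∅} with hS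
  have hSne : S.Nonempty := by
    obtain ⟨t, ht⟩ := hΛad_ne
    obtain ⟨x, hx⟩ := exists_nash_equilibrium X hXne hXcp hXcv (fun ν => C ν t) (fun ν => P ν t)
      (fun ν => hCsub ν t) (fun ν => hCusc ν t) (fun ν => hPusc ν t) (fun ν => hCcp ν t)
      (fun ν => hCcv ν t) (fun ν => hPcp ν t) (fun ν => hPcv ν t) (fun ν => hCne ν t)
      (fun ν => (hI ν t).symm ▸ hIopen ν)
      (fun ν x hC hP => by
        have := hΨ1 ν t x hC _ hP
        rw [dist_self] at this
        exact this.not_gt hτ)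
    exact ⟨(t, x), ht, hx⟩
  have hScl : IsClosed S := by
    simp only [hS, hdisj, ofPred_and, ofPred_forall]
    refine (hΛad_cl.preimage continuous_fst).inter (isClosed_iInter fun ν => IsClosed.inter ?_
      ((hIopen ν).isClosed_compl.preimage continuous_snd))
    refine isClosed_setOf_mem_of_hausdorffEDist (hCusc ν) (fun t x => (hCcp ν t x).isClosed)
      (fun t ε hε => ?_) (continuous_subtype_val.comp (continuous_apply ν))
    obtain ⟨V, hV, hVε⟩ := hcont t ε hε
    filter_upwards [hV] with t' ht' x
    refine lt_of_le_of_lt ?_ (hVε t' ht')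
    refine le_trans ?_ (Finset.single_le_sum (fun _ _ => zero_le) (Finset.mem_univ ν))
    exact (le_iSup (fun x => hausdorffEDist (C ν t' x) (C ν t x)) x).trans le_self_add
  obtain ⟨⟨t, x⟩, ⟨ht, hx⟩, hmin⟩ :=
    (hF.lowerSemicontinuousOn S).exists_isMinOn hSne hScl.isCompact
  exact ⟨t, ht, x, hx, fun t' ht' x' hx' => hmin (show (t', x') ∈ S from ⟨ht', hx'⟩)⟩
end
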